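/- Let n ≥ 5, and let M be a symmetric non-degenerate real (n−1)×(n−1) matrix. Define F on 𝔽₂(ℝ^{n−1}) = {(x,y) ∈ ℝ^{n−1}×ℝ^{n−1} : x ≠ y} by F(x,y) = (1/2)⟨Mx,x⟩ + (1/2)⟨My,y⟩ + 1/|x−y|^{n−2}, and set c̄ = (n−2)/2^{n−1}. Then at every critical point (x,y) of F one has y = −x and Mx = c̄ x/|x|^n; in particular x is an eigenvector of M with positive eigenvalue c̄/|x|^n, so the existence of a critical point of F forces M to have a positive eigenvalue. -/

import Mathlib

open scoped RealInnerProductSpace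

section

variable {E : Type*} [NormedAddCommGroup E] [InnerProductSpace ℝ E]

lemma hasFDerivAt_norm_of_ne_zero {v : E} (hv : v ≠ 0) :
    HasFDerivAt (fun w : E => ‖w‖) (‖v‖⁻¹ • innerSL ℝ v) v := by
  have hpos : 0 < ‖v‖ := norm_pos_iff.mpr hv
  have h := (hasStrictFDerivAt_norm_sq v).hasFDerivAt.sqrt (pow_pos hpos 2).ne'
  simp only [Real.sqrt_sq (norm_nonneg _)] at h
  refine h.congr_fderiv ?_
  ext w
  simp
  field_simp

lemma hasFDerivAt_one_div_norm_pow {v : E} (hv : v ≠ 0) (m : ℕ) :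
    HasFDerivAt (fun w : E => 1 / ‖w‖ ^ m) (-(m / ‖v‖ ^ (m + 2)) • innerSL ℝ v) v := by
  have hne : ‖v‖ ≠ 0 := norm_ne_zero_iff.mpr hv
  have h := ((hasDerivAt_pow m ‖v‖).inv (pow_ne_zero m hne)).comp_hasFDerivAt v
    (hasFDerivAt_norm_of_ne_zero hv)
  simp only [one_div]
  refine h.congr_fderiv ?_
  rw [smul_smul]
  congr 1
  rcases m with _ | m
  · simp
  · simp only [Nat.add_sub_cancel]
    field_simp
    ring

lemma hasFDerivAt_half_inner_self (L : E →L[ℝ] E) (hsymm : ∀ x y, ⟪L x, y⟫ = ⟪x, L y⟫) (x : E) :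
    HasFDerivAt (fun z : E => (1 / 2 : ℝ) * ⟪L z, z⟫) (innerSL ℝ (L x)) x := by
  have h := (L.hasFDerivAt (x := x)).inner ℝ (hasFDerivAt_id x)
  refine (h.const_mul (1 / 2 : ℝ)).congr_fderiv ?_
  ext w
  have h1 : ⟪L w, x⟫ = ⟪L x, w⟫ := by rw [hsymm, real_inner_comm]
  simp [h1]
  ring

/-- The derivative of the energy of two points in a quadratic potential with a repulsive
interaction `1 / ‖x - y‖ ^ m`. -/
lemma hasFDerivAt_quadratic_add_repulsion (L : E →L[ℝ] E)
    (hsymm : ∀ x y, ⟪L x, y⟫ = ⟪x, L y⟫) (m : ℕ) {x y : E} (hxy : x ≠ y) :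
    HasFDerivAt (fun p : E × E => (1 / 2) * ⟪L p.1, p.1⟫ + (1 / 2) * ⟪L p.2, p.2⟫
        + 1 / ‖p.1 - p.2‖ ^ m)
      ((innerSL ℝ (L x)).comp (ContinuousLinearMap.fst ℝ E E)
        + (innerSL ℝ (L y)).comp (ContinuousLinearMap.snd ℝ E E)
        + (-(m / ‖x - y‖ ^ (m + 2)) • innerSL ℝ (x - y)).comp
          (ContinuousLinearMap.fst ℝ E E - ContinuousLinearMap.snd ℝ E E)) (x, y) := by
  have hfst : HasFDerivAt (Prod.fst : E × E → E) (ContinuousLinearMap.fst ℝ E E) (x, y) :=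
    hasFDerivAt_fst
  have hsnd : HasFDerivAt (Prod.snd : E × E → E) (ContinuousLinearMap.snd ℝ E E) (x, y) :=
    hasFDerivAt_snd
  exact (((hasFDerivAt_half_inner_self L hsymm x).comp (x, y) hfst).add
    ((hasFDerivAt_half_inner_self L hsymm y).comp (x, y) hsnd)).add
    (HasFDerivAt.comp (x, y) (hasFDerivAt_one_div_norm_pow (sub_ne_zero.mpr hxy) m)
      (hfst.sub hsnd))

lemma critical_equations_of_fderiv_eq_zero (L : E →L[ℝ] E)
    (hsymm : ∀ x y, ⟪L x, y⟫ = ⟪x, L y⟫) (m : ℕ) {x y : E} (hxy : x ≠ y)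
    (h : fderiv ℝ (fun p : E × E => (1 / 2) * ⟪L p.1, p.1⟫ + (1 / 2) * ⟪L p.2, p.2⟫
        + 1 / ‖p.1 - p.2‖ ^ m) (x, y) = 0) :
    L x = (m / ‖x - y‖ ^ (m + 2)) • (x - y) ∧ L y = -((m / ‖x - y‖ ^ (m + 2)) • (x - y)) := by
  rw [(hasFDerivAt_quadratic_add_repulsion L hsymm m hxy).fderiv] at h
  constructor
  · refine ext_inner_right ℝ fun w => ?_
    have hw := congrArg (fun T => T (w, 0)) h
    simp [-neg_smul, -map_sub] at hw
    rw [real_inner_smul_left]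
    linarith
  · refine ext_inner_right ℝ fun w => ?_
    have hw := congrArg (fun T => T (0, w)) h
    simp [-neg_smul, -map_sub] at hw
    rw [inner_neg_left, real_inner_smul_left]
    linarith

end

/-- At every critical point `(x, y)` of `F` one has `y = -x` and
`Mx = c̄ x/|x|^n` with `c̄ = (n-2)/2^(n-1)`; in particular `x` is an eigenvector of `M`
with positive eigenvalue `c̄/|x|^n`, so the existence of a critical point of `F` forces
`M` to have a positive eigenvalue. -/
theorem stmt_6 (n : ℕ) (hn : 5 ≤ n)
    (M : EuclideanSpace ℝ (Fin (n - 1)) →ₗ[ℝ] EuclideanSpace ℝ (Fin (n - 1)))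
    (hsymm : ∀ x y, ⟪M x, y⟫ = ⟪x, M y⟫)
    (hnondeg : Function.Bijective M)
    (c : ℝ) (hc : c = ((n : ℝ) - 2) / 2 ^ (n - 1))
    (F : EuclideanSpace ℝ (Fin (n - 1)) × EuclideanSpace ℝ (Fin (n - 1)) → ℝ)
    (hF : ∀ p, F p = (1 / 2) * ⟪M p.1, p.1⟫ + (1 / 2) * ⟪M p.2, p.2⟫
      + 1 / ‖p.1 - p.2‖ ^ (n - 2)) :
    (∀ x y : EuclideanSpace ℝ (Fin (n - 1)), x ≠ y → fderiv ℝ F (x, y) = 0 →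
      y = -x ∧ x ≠ 0 ∧ M x = (c / ‖x‖ ^ n) • x ∧ 0 < c / ‖x‖ ^ n) ∧
    ((∃ x y : EuclideanSpace ℝ (Fin (n - 1)), x ≠ y ∧ fderiv ℝ F (x, y) = 0) →
      ∃ (lam : ℝ) (v : EuclideanSpace ℝ (Fin (n - 1))),
        0 < lam ∧ v ≠ 0 ∧ M v = lam • v) := by
  have main : ∀ x y : EuclideanSpace ℝ (Fin (n - 1)), x ≠ y → fderiv ℝ F (x, y) = 0 →
      y = -x ∧ x ≠ 0 ∧ M x = (c / ‖x‖ ^ n) • x ∧ 0 < c / ‖x‖ ^ n := by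
    intro x y hxy hcrit
    obtain ⟨m, rfl⟩ : ∃ m, n = m + 2 := ⟨n - 2, by omega⟩
    obtain ⟨hx, hy⟩ : M x = (m / ‖x - y‖ ^ (m + 2)) • (x - y) ∧
        M y = -((m / ‖x - y‖ ^ (m + 2)) • (x - y)) := by
      rw [funext hF] at hcrit
      exact critical_equations_of_fderiv_eq_zero M.toContinuousLinearMap hsymm m hxy hcrit
    have hyx : y = -x := hnondeg.injective (by rw [map_neg, hx, hy])
    subst hyx
    have hx0 : x ≠ 0 := by
      rintro rfl
      simp at hxy
    have hpos : 0 < ‖x‖ := norm_pos_iff.mpr hx0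
    have hm : (0 : ℝ) < m := by
      exact_mod_cast (by omega : 0 < m)
    have hc' : c = m / 2 ^ (m + 1) := by
      rw [hc]
      simp
    refine ⟨rfl, hx0, ?_, ?_⟩
    · have h2 : x - -x = (2 : ℝ) • x := by rw [two_smul, sub_neg_eq_add]
      rw [hx, h2, smul_smul, norm_smul, hc']
      congr 1
      rw [Real.norm_ofNat, mul_pow]
      field_simp
      ring
    · rw [hc']
      positivity
  refine ⟨main, ?_⟩
  rintro ⟨x, y, hxy, hcrit⟩
  obtain ⟨-, hx0, hM, hpos⟩ := main x y hxy hcrit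
  exact ⟨_, x, hpos, hx0, hM⟩
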